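/- There is an absolute constant C (one may take C = 100) such that for every natural number n, the number of regular couples of scale n is at most C^n. -/

import Mathlib

namespace WKE

/-! Combinatorial framework: ternary trees, couples, steps A and B, regular couples.
Following Deng–Hani, "Full derivation of the wave kinetic equation". -/

/-- A ternary tree: every non-leaf (branching) node has exactly three ordered children. -/
inductive TTree : Type where
  | leaf : TTree
  | node : TTree → TTree → TTree → TTree
  deriving DecidableEq

/-- The scale of a tree: its number of branching nodes. -/
def TTree.scale : TTree → ℕ
  | .leaf => 0
  | .node a b c => a.scale + b.scale + c.scale + 1

/-- A position (address) of a node in a ternary tree. -/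
abbrev Pos : Type := List (Fin 3)

/-- A node of a couple: a side (`true` = the `+` tree) together with a position. -/
abbrev NodeId : Type := Bool × Pos

/-- The subtree at a given position, if the position is valid. -/
def TTree.subtreeAt? : TTree → Pos → Option TTree
  | t, [] => some t
  | .leaf, _ :: _ => none
  | .node a _ _, ⟨0, _⟩ :: p => a.subtreeAt? p
  | .node _ b _, ⟨1, _⟩ :: p => b.subtreeAt? p
  | .node _ _ c, ⟨_ + 2, _⟩ :: p => c.subtreeAt? p

/-- `p` is the position of a leaf of `t`. -/
def TTree.IsLeafPos (t : TTree) (p : Pos) : Prop := t.subtreeAt? p = some .leaf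

/-- `p` is the position of a branching node of `t`. -/
def TTree.IsBranchPos (t : TTree) (p : Pos) : Prop :=
  ∃ a b c, t.subtreeAt? p = some (.node a b c)

instance (t : TTree) (p : Pos) : Decidable (t.IsLeafPos p) := by
  unfold TTree.IsLeafPos; infer_instance

/-- The sign of the node at position `p` in a tree whose root has sign `b`
(`true` = `+`): the sign flips exactly when passing to a middle child. -/
def posSign (b : Bool) (p : Pos) : Bool := Bool.xor b (p.count (1 : Fin 3) % 2 == 1)

/-- A couple: a pair of ternary trees of signs `+` and `-`, together with a partition of the
set of all leaves into pairs of leaves of opposite signs.  The pairing is encoded as a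
fixed-point-free involution of the set of leaves, extended by the identity off the leaves. -/
structure Couple where
  pos : TTree
  neg : TTree
  pair : NodeId → NodeId
  pair_leaf : ∀ x : NodeId, (cond x.1 pos neg).IsLeafPos x.2 →
    (cond (pair x).1 pos neg).IsLeafPos (pair x).2
  pair_invol : ∀ x : NodeId, (cond x.1 pos neg).IsLeafPos x.2 → pair (pair x) = x
  pair_ne : ∀ x : NodeId, (cond x.1 pos neg).IsLeafPos x.2 → pair x ≠ x
  pair_sign : ∀ x : NodeId, (cond x.1 pos neg).IsLeafPos x.2 →
    posSign (pair x).1 (pair x).2 = !(posSign x.1 x.2)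
  pair_norm : ∀ x : NodeId, ¬ (cond x.1 pos neg).IsLeafPos x.2 → pair x = x

/-- The tree of a couple on a given side. -/
def Couple.treeOf (Q : Couple) (b : Bool) : TTree := cond b Q.pos Q.neg

/-- `x` is a leaf of the couple `Q`. -/
def Couple.IsLeaf (Q : Couple) (x : NodeId) : Prop := (Q.treeOf x.1).IsLeafPos x.2

/-- `x` is a branching node of the couple `Q`. -/
def Couple.IsBranch (Q : Couple) (x : NodeId) : Prop := (Q.treeOf x.1).IsBranchPos x.2

/-- `x` is a node of the couple `Q`. -/
def Couple.IsNode (Q : Couple) (x : NodeId) : Prop := ((Q.treeOf x.1).subtreeAt? x.2).isSome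

/-- The scale of a couple: the sum of the scales of its two trees. -/
def Couple.scale (Q : Couple) : ℕ := Q.pos.scale + Q.neg.scale

theorem isLeafPos_leaf_iff (p : Pos) : TTree.IsLeafPos .leaf p ↔ p = [] := by
  cases p with
  | nil => simp [TTree.IsLeafPos, TTree.subtreeAt?]
  | cons i q => simp [TTree.IsLeafPos, TTree.subtreeAt?]

/-- The pairing of the trivial couple: the two roots are paired. -/
def trivPair : NodeId → NodeId := fun x =>
  if x = ((true, []) : NodeId) then ((false, []) : NodeId)
  else if x = ((false, []) : NodeId) then ((true, []) : NodeId) else x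

/-- The trivial couple: two single-node trees with their roots paired. -/
def trivialCouple : Couple where
  pos := .leaf
  neg := .leaf
  pair := trivPair
  pair_leaf := by
    rintro ⟨b, p⟩ hp
    have hp' : p = [] := by cases b <;> exact (isLeafPos_leaf_iff p).mp hp
    subst hp'
    cases b <;> decide
  pair_invol := by
    rintro ⟨b, p⟩ hp
    have hp' : p = [] := by cases b <;> exact (isLeafPos_leaf_iff p).mp hp
    subst hp'
    cases b <;> decide
  pair_ne := by
    rintro ⟨b, p⟩ hp
    have hp' : p = [] := by cases b <;> exact (isLeafPos_leaf_iff p).mp hp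
    subst hp'
    cases b <;> decide
  pair_sign := by
    rintro ⟨b, p⟩ hp
    have hp' : p = [] := by cases b <;> exact (isLeafPos_leaf_iff p).mp hp
    subst hp'
    cases b <;> decide
  pair_norm := by
    rintro ⟨b, p⟩ hp
    rcases p with _ | ⟨i, q⟩
    · exfalso
      apply hp
      cases b <;> exact (isLeafPos_leaf_iff []).mpr rfl
    · simp [trivPair]

/-- Replace the subtree at position `p` of `t` by `s`. -/
def TTree.replaceAt : TTree → Pos → TTree → TTree
  | _, [], s => s
  | .leaf, _ :: _, _ => .leaf
  | .node a b c, ⟨0, _⟩ :: p, s => .node (a.replaceAt p s) b c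
  | .node a b c, ⟨1, _⟩ :: p, s => .node a (b.replaceAt p s) c
  | .node a b c, ⟨_ + 2, _⟩ :: p, s => .node a b (c.replaceAt p s)

/-- The ternary tree of scale 1. -/
def oneTree : TTree := .node .leaf .leaf .leaf

/-- Normalize a candidate pairing function: act by `f` on the leaves of the couple with
trees `P`, `N`, and by the identity elsewhere. -/
def normalizePair (P N : TTree) (f : NodeId → NodeId) : NodeId → NodeId :=
  fun x => if (cond x.1 P N).IsLeafPos x.2 then f x else x

/-- The transposition of `0` and `2` in `Fin 3`. -/
def swap02 : Fin 3 → Fin 3 := fun i => if i = 0 then 2 else if i = 2 then 0 else 1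

/-- The new (raw) pairing after step A performed at the leaf pair `{l, l'}`; the children
of `l` are paired to the children of `l'` according to `σ` (which is `id` or `swap02`),
corresponding to the two possible (1,1)-mini couples. -/
def stepAPairRaw (f : NodeId → NodeId) (l l' : NodeId) (σ : Fin 3 → Fin 3) :
    NodeId → NodeId := fun x =>
  if x = (l.1, l.2 ++ [(0 : Fin 3)]) then (l'.1, l'.2 ++ [σ 0])
  else if x = (l.1, l.2 ++ [(1 : Fin 3)]) then (l'.1, l'.2 ++ [σ 1])
  else if x = (l.1, l.2 ++ [(2 : Fin 3)]) then (l'.1, l'.2 ++ [σ 2])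
  else if x = (l'.1, l'.2 ++ [σ 0]) then (l.1, l.2 ++ [(0 : Fin 3)])
  else if x = (l'.1, l'.2 ++ [σ 1]) then (l.1, l.2 ++ [(1 : Fin 3)])
  else if x = (l'.1, l'.2 ++ [σ 2]) then (l.1, l.2 ++ [(2 : Fin 3)])
  else f x

/-- Graft the tree `s` at the positions of `l` and of `l'` that lie on the side `c`. -/
def graft2 (t : TTree) (c : Bool) (l l' : NodeId) (s : TTree) : TTree :=
  let t1 := if l.1 = c then t.replaceAt l.2 s else t
  if l'.1 = c then t1.replaceAt l'.2 s else t1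

/-- Step A: `Q'` is obtained from `Q` by replacing a pair of paired leaves by a
(1,1)-mini couple. -/
def StepA (Q Q' : Couple) : Prop :=
  ∃ (l : NodeId) (σ : Fin 3 → Fin 3),
    Q.IsLeaf l ∧ (σ = id ∨ σ = swap02) ∧
    Q'.pos = graft2 Q.pos true l (Q.pair l) oneTree ∧
    Q'.neg = graft2 Q.neg false l (Q.pair l) oneTree ∧
    Q'.pair = normalizePair Q'.pos Q'.neg (stepAPairRaw Q.pair l (Q.pair l) σ)

/-- The relative position (among the grandchildren) of the lone leaf of the mini tree with
parameters `(i, v)`. -/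
def loneIdx (i : Fin 3) (v : Bool) : Fin 3 := if i = 1 then 1 else cond v 0 2

/-- The two leaf pairs (as relative positions) of the mini tree with parameters `(i, v)`:
`i` is the index of the child of the root which is a branching node, and `v` selects one of
the two admissible pairings; together `(i, v)` ranges over the six possible mini trees. -/
def bPairs (i : Fin 3) (v : Bool) : (Pos × Pos) × (Pos × Pos) :=
  if i = 1 then
    cond v ((([0], [1, 2]), ([2], [1, 0]))) ((([0], [1, 0]), ([2], [1, 2])))
  else if i = 0 then
    (([2], [0, 1]), cond v ([1], [0, 2]) ([1], [0, 0]))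
  else
    (([0], [2, 1]), cond v ([1], [2, 2]) ([1], [2, 0]))

/-- The branching child of the root of a mini tree: the subtree `S` is reattached at the
lone leaf (grandchild number `lone`). -/
def gchildT (lone : Fin 3) (S : TTree) : TTree :=
  .node (if lone = 0 then S else .leaf) (if lone = 1 then S else .leaf)
    (if lone = 2 then S else .leaf)

/-- The mini tree with branching child in position `i` and the subtree `S` reattached at the
lone leaf (grandchild number `lone`). -/
def miniT (i lone : Fin 3) (S : TTree) : TTree :=
  .node (if i = 0 then gchildT lone S else .leaf) (if i = 1 then gchildT lone S else .leaf)
    (if i = 2 then gchildT lone S else .leaf)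

/-- Relabelling of positions under step B performed at `(c, q)`: nodes below `q` on side `c`
move below the lone leaf `q ++ [i, lone]`. -/
def bump (c : Bool) (q : Pos) (i lone : Fin 3) (x : NodeId) : NodeId :=
  if x.1 = c ∧ q <+: x.2 then (x.1, q ++ i :: lone :: x.2.drop q.length) else x

/-- The new (raw) pairing after step B performed at `(c, q)` with mini tree parameters
`(i, v)`. -/
def stepBPairRaw (f : NodeId → NodeId) (c : Bool) (q : Pos) (i : Fin 3) (v : Bool) :
    NodeId → NodeId := fun x =>
  if x = (c, q ++ (bPairs i v).1.1) then (c, q ++ (bPairs i v).1.2)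
  else if x = (c, q ++ (bPairs i v).1.2) then (c, q ++ (bPairs i v).1.1)
  else if x = (c, q ++ (bPairs i v).2.1) then (c, q ++ (bPairs i v).2.2)
  else if x = (c, q ++ (bPairs i v).2.2) then (c, q ++ (bPairs i v).2.1)
  else if x.1 = c ∧ (q ++ [i, loneIdx i v]) <+: x.2 then
    bump c q i (loneIdx i v) (f (c, q ++ x.2.drop (q.length + 2)))
  else bump c q i (loneIdx i v) (f x)

/-- Step B performed at the node `(c, q)` with mini tree parameters `(i, v)`: the node is
replaced by a mini tree, the subtree originally rooted there being reattached at the lone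
leaf of the mini tree. -/
def StepBAt (Q Q' : Couple) (c : Bool) (q : Pos) (i : Fin 3) (v : Bool) : Prop :=
  ∃ S : TTree, (Q.treeOf c).subtreeAt? q = some S ∧
    Q'.treeOf c = (Q.treeOf c).replaceAt q (miniT i (loneIdx i v) S) ∧
    Q'.treeOf (!c) = Q.treeOf (!c) ∧
    Q'.pair = normalizePair Q'.pos Q'.neg (stepBPairRaw Q.pair c q i v)

/-- Step B: `Q'` is obtained from `Q` by replacing some node by a mini tree. -/
def StepB (Q Q' : Couple) : Prop := ∃ c q i v, StepBAt Q Q' c q i v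

/-- One application of step A or step B. -/
def Step (Q Q' : Couple) : Prop := StepA Q Q' ∨ StepB Q Q'

/-- A regular couple: one obtained from the trivial couple by finitely many applications of
steps A and B. -/
def Regular (Q : Couple) : Prop := Relation.ReflTransGen Step trivialCouple Q

/-! ### Subtrees and replacement -/

theorem subtreeAt?_nil (t : TTree) : t.subtreeAt? [] = some t := by
  cases t <;> rfl

theorem subtreeAt?_append (t : TTree) (p r : Pos) :
    t.subtreeAt? (p ++ r) = (t.subtreeAt? p).bind (fun s => s.subtreeAt? r) := by
  induction p generalizing t with
  | nil => simp [subtreeAt?_nil]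
  | cons i p ih =>
    cases t with
    | leaf => simp [TTree.subtreeAt?]
    | node a b c => fin_cases i <;> simp [TTree.subtreeAt?, ih]

theorem replaceAt_append (t S s : TTree) (p r : Pos) (h : t.subtreeAt? p = some S) :
    (t.replaceAt p s).subtreeAt? (p ++ r) = s.subtreeAt? r := by
  induction p generalizing t with
  | nil => cases t <;> simp [TTree.replaceAt]
  | cons i p ih =>
    cases t with
    | leaf => simp [TTree.subtreeAt?] at h
    | node a b c =>
      fin_cases i <;> simp [TTree.subtreeAt?, TTree.replaceAt] at h ⊢ <;> exact ih _ h

theorem replaceAt_leaf (t s : TTree) (q p : Pos) (hq : ¬ q <+: p) (h : t.IsLeafPos p) :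
    (t.replaceAt q s).IsLeafPos p := by
  unfold TTree.IsLeafPos at *
  induction q generalizing t p with
  | nil => simp at hq
  | cons i q ih =>
    cases t with
    | leaf => simpa [TTree.replaceAt] using h
    | node a b c =>
      cases p with
      | nil => simp [TTree.subtreeAt?] at h
      | cons j p =>
        have hij : i = j → ¬ q <+: p := by
          intro e hp; apply hq; subst e; simpa using hp
        fin_cases i <;> fin_cases j <;>
          simp [TTree.subtreeAt?, TTree.replaceAt] at h hij ⊢ <;>
          first | exact h | exact ih _ _ hij h

theorem replaceAt_branch (t s : TTree) (q p : Pos) (hq : ¬ q <+: p) (h : t.IsBranchPos p) :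
    (t.replaceAt q s).IsBranchPos p := by
  unfold TTree.IsBranchPos at *
  induction q generalizing t p with
  | nil => simp at hq
  | cons i q ih =>
    cases t with
    | leaf => simpa [TTree.replaceAt] using h
    | node a b c =>
      cases p with
      | nil => fin_cases i <;> simp [TTree.subtreeAt?, TTree.replaceAt]
      | cons j p =>
        have hij : i = j → ¬ q <+: p := by
          intro e hp; apply hq; subst e; simpa using hp
        fin_cases i <;> fin_cases j <;>
          simp [TTree.subtreeAt?, TTree.replaceAt] at h hij ⊢ <;>
          first | exact h | exact ih _ _ hij h

/-- The `j`-th child of a node. -/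
def child (x : NodeId) (j : Fin 3) : NodeId := (x.1, x.2 ++ [j])

/-- The subtree of a couple at a node. -/
def Couple.sub (Q : Couple) (x : NodeId) : Option TTree := (Q.treeOf x.1).subtreeAt? x.2

/-- The three children of a branching node. -/
def pick (a b c : TTree) (j : Fin 3) : TTree := if j = 0 then a else if j = 1 then b else c

theorem subtreeAt?_child (t a b c : TTree) (p : Pos) (j : Fin 3)
    (h : t.subtreeAt? p = some (.node a b c)) :
    t.subtreeAt? (p ++ [j]) = some (pick a b c j) := by
  rw [subtreeAt?_append, h]
  fin_cases j <;> simp [TTree.subtreeAt?, pick, subtreeAt?_nil]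

theorem sub_child (Q : Couple) (x : NodeId) (a b c : TTree) (j : Fin 3)
    (h : Q.sub x = some (.node a b c)) : Q.sub (child x j) = some (pick a b c j) :=
  subtreeAt?_child _ _ _ _ _ _ h

theorem leaf_prefix (t s : TTree) (q p : Pos) (hq : t.IsLeafPos q) (hp : t.subtreeAt? p = some s)
    (h : q <+: p) : p = q := by
  obtain ⟨r, rfl⟩ := h
  rw [subtreeAt?_append, hq] at hp
  cases r with
  | nil => simp
  | cons i r => simp [TTree.subtreeAt?] at hp

/-! ### Terms describing regular couples -/

abbrev P3 : Type := Equiv.Perm (Fin 3)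

/-- Terms. -/
inductive Tm : Type where
  | nil : Tm
  | A : P3 → Tm → Tm → Tm → Tm
  | B : Bool → P3 → P3 → Tm → Tm → Tm → Tm → Tm

def Tm.size : Tm → ℕ
  | .nil => 0
  | .A _ a b c => a.size + b.size + c.size + 1
  | .B _ _ _ a b c d => a.size + b.size + c.size + d.size + 1

/-- `R Q true x y t`: the term `t` describes the part of `Q` below the nodes `x`, `y` (which is
itself a regular couple); `R Q false x y t`: the term `t` describes the part of `Q` between `x` and
its descendant `y`, which is a regular tree with lone leaf `y`. -/
inductive R (Q : Couple) : Bool → NodeId → NodeId → Tm → Prop where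
  | cnil (x : NodeId) : R Q false x x .nil
  | pnil (x y : NodeId) : Q.IsLeaf x → Q.IsLeaf y → Q.pair x = y → Q.pair y = x →
      R Q true x y .nil
  | a (x y : NodeId) (σ : P3) (t0 t1 t2 : Tm) : Q.IsBranch x → Q.IsBranch y →
      R Q true (child x 0) (child y (σ 0)) t0 → R Q true (child x 1) (child y (σ 1)) t1 →
      R Q true (child x 2) (child y (σ 2)) t2 → R Q true x y (.A σ t0 t1 t2)
  | bl (k : Bool) (x m y : NodeId) (π ρ : P3) (t0 t1 t2 t3 : Tm) : Q.IsBranch x → Q.IsBranch m →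
      R Q false (child x (π 0)) m t0 → R Q true (child x (π 1)) (child m (ρ 1)) t1 →
      R Q true (child x (π 2)) (child m (ρ 2)) t2 → R Q k (child m (ρ 0)) y t3 →
      R Q k x y (.B true π ρ t0 t1 t2 t3)
  | br (x m y : NodeId) (π ρ : P3) (t0 t1 t2 t3 : Tm) : Q.IsBranch y → Q.IsBranch m →
      R Q false (child y (π 0)) m t0 → R Q true (child y (π 1)) (child m (ρ 1)) t1 →
      R Q true (child y (π 2)) (child m (ρ 2)) t2 → R Q true x (child m (ρ 0)) t3 →
      R Q true x y (.B false π ρ t0 t1 t2 t3)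

/-! ### Size -/

/-- The scale of the subtree at a node. -/
def Couple.sc (Q : Couple) (x : NodeId) : ℕ := ((Q.sub x).map TTree.scale).getD 0

theorem sc_branch (Q : Couple) (x : NodeId) (h : Q.IsBranch x) :
    Q.sc x = Q.sc (child x 0) + Q.sc (child x 1) + Q.sc (child x 2) + 1 := by
  obtain ⟨a, b, c, h⟩ := h
  have h' : Q.sub x = some (.node a b c) := h
  simp [Couple.sc, sub_child Q x a b c _ h', h', pick, TTree.scale]

theorem perm_sum (f : Fin 3 → ℕ) (π : P3) : f (π 0) + f (π 1) + f (π 2) = f 0 + f 1 + f 2 := by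
  have := Equiv.sum_comp π f
  simpa [Fin.sum_univ_three] using this

theorem R_size (Q : Couple) (k : Bool) (x y : NodeId) (t : Tm) (h : R Q k x y t) :
    if k then Q.sc x + Q.sc y = 2 * t.size else Q.sc x = Q.sc y + 2 * t.size := by
  induction h with
  | cnil x => simp [Tm.size]
  | pnil x y hx hy _ _ =>
    have hx' : Q.sub x = some .leaf := hx
    have hy' : Q.sub y = some .leaf := hy
    simp [Couple.sc, hx', hy', Tm.size, TTree.scale]
  | a x y σ t0 t1 t2 hx hy _ _ _ i0 i1 i2 =>
    have e1 := sc_branch Q x hx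
    have e2 := sc_branch Q y hy
    have e3 := perm_sum (fun j => Q.sc (child y j)) σ
    simp only [if_true, Tm.size] at *
    omega
  | bl k x m y π ρ t0 t1 t2 t3 hx hy _ _ _ _ i0 i1 i2 i3 =>
    have e1 := sc_branch Q x hx
    have e2 := sc_branch Q m hy
    have e3 := perm_sum (fun j => Q.sc (child x j)) π
    have e4 := perm_sum (fun j => Q.sc (child m j)) ρ
    cases k <;> simp [Tm.size] at * <;> omega
  | br x m y π ρ t0 t1 t2 t3 hx hy _ _ _ _ i0 i1 i2 i3 =>
    have e1 := sc_branch Q y hx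
    have e2 := sc_branch Q m hy
    have e3 := perm_sum (fun j => Q.sc (child y j)) π
    have e4 := perm_sum (fun j => Q.sc (child m j)) ρ
    simp [Tm.size] at *
    omega

/-! ### Determinism -/

/-- `z` lies (weakly) below `x`. -/
def Below (x z : NodeId) : Prop := x.1 = z.1 ∧ x.2 <+: z.2

theorem below_child (Q : Couple) (x z : NodeId) (hx : Q.IsBranch x) (hz : Q.IsLeaf z)
    (h : Below x z) : ∃ j, Below (child x j) z := by
  obtain ⟨b, p⟩ := x
  obtain ⟨b', p'⟩ := z
  obtain ⟨h1, r, h2⟩ := h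
  simp only at h1 h2
  subst h1 h2
  cases r with
  | nil =>
    obtain ⟨a, b, c, hx⟩ := hx
    have hz' := hz
    unfold Couple.IsLeaf TTree.IsLeafPos at hz'
    simp only [List.append_nil] at hz' hx
    rw [hx] at hz'
    simp at hz'
  | cons j r => exact ⟨j, rfl, r, by simp [child]⟩

theorem sub_eq_of (Q Q' : Couple) (x : NodeId) (h : Q.IsBranch x) (h' : Q'.IsBranch x)
    (e : ∀ j, Q.sub (child x j) = Q'.sub (child x j)) : Q.sub x = Q'.sub x := by
  obtain ⟨a, b, c, h⟩ := h
  obtain ⟨a', b', c', h'⟩ := h'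
  have h1 : Q.sub x = some (.node a b c) := h
  have h1' : Q'.sub x = some (.node a' b' c') := h'
  have := fun j => (sub_child Q x a b c j h1).symm.trans ((e j).trans (sub_child Q' x _ _ _ j h1'))
  have e0 := this 0
  have e1 := this 1
  have e2 := this 2
  simp [pick] at e0 e1 e2
  rw [h1, h1', e0, e1, e2]

theorem all_perm {p : Fin 3 → Prop} (π : P3) (h0 : p (π 0)) (h1 : p (π 1)) (h2 : p (π 2)) :
    ∀ j, p j := by
  intro j
  obtain ⟨i, rfl⟩ := π.surjective j
  fin_cases i <;> assumption

/-- The two pairings agree on the leaves below `x`. -/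
def Agree (Q Q' : Couple) (x : NodeId) : Prop :=
  ∀ z, Below x z → Q.IsLeaf z → Q.pair z = Q'.pair z

theorem agree_of (Q Q' : Couple) (x : NodeId) (hx : Q.IsBranch x)
    (h : ∀ j, Agree Q Q' (child x j)) : Agree Q Q' x := by
  intro z hz hl
  obtain ⟨j, hj⟩ := below_child Q x z hx hl hz
  exact h j z hj hl

theorem agree_leaf (Q Q' : Couple) (x : NodeId) (hx : Q.IsLeaf x) (h : Q.pair x = Q'.pair x) :
    Agree Q Q' x := by
  rintro ⟨b, p⟩ ⟨h1, h2⟩ hl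
  obtain ⟨b', p'⟩ := x
  simp only at h1 h2
  subst h1
  have : p = p' := leaf_prefix _ _ _ _ hx hl h2
  subst this
  exact h

/-- Same subtree and same pairing below `x`. -/
def Same (Q Q' : Couple) (x : NodeId) : Prop := Q.sub x = Q'.sub x ∧ Agree Q Q' x

theorem same_of (Q Q' : Couple) (x : NodeId) (hx : Q.IsBranch x) (hx' : Q'.IsBranch x) (π : P3)
    (h0 : Same Q Q' (child x (π 0))) (h1 : Same Q Q' (child x (π 1)))
    (h2 : Same Q Q' (child x (π 2))) : Same Q Q' x := by
  have := all_perm (p := fun j => Same Q Q' (child x j)) π h0 h1 h2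
  exact ⟨sub_eq_of Q Q' x hx hx' fun j => (this j).1, agree_of Q Q' x hx fun j => (this j).2⟩

theorem R_det (Q Q' : Couple) (k : Bool) (x y : NodeId) (t : Tm) (h : R Q k x y t) :
    ∀ y', (k = true → y' = y) → R Q' k x y' t →
      if k then Same Q Q' x ∧ Same Q Q' y else y' = y ∧ (Same Q Q' y → Same Q Q' x) := by
  induction h with
  | cnil x =>
    intro y' _ h'
    cases h'
    simp
  | pnil x y hx hy e1 e2 =>
    intro y' hk h'
    obtain rfl := hk rfl
    cases h' with
    | pnil _ _ hx' hy' e1' e2' =>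
      simp only [if_true]
      exact ⟨⟨Eq.trans hx (Eq.symm hx'), agree_leaf _ _ _ hx (e1.trans e1'.symm)⟩,
        ⟨Eq.trans hy (Eq.symm hy'), agree_leaf _ _ _ hy (e2.trans e2'.symm)⟩⟩
  | a x y σ t0 t1 t2 hx hy _ _ _ i0 i1 i2 =>
    intro y' hk h'
    obtain rfl := hk rfl
    cases h' with
    | a _ _ _ _ _ _ hx' hy' r0 r1 r2 =>
      have j0 := i0 _ (fun _ => rfl) r0
      have j1 := i1 _ (fun _ => rfl) r1
      have j2 := i2 _ (fun _ => rfl) r2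
      simp only [if_true] at *
      exact ⟨same_of Q Q' x hx hx' 1 j0.1 j1.1 j2.1, same_of Q Q' _ hy hy' σ j0.2 j1.2 j2.2⟩
  | bl k x m y π ρ t0 t1 t2 t3 hx hm _ _ _ _ i0 i1 i2 i3 =>
    intro y' hk h'
    cases h' with
    | bl _ _ m' _ _ _ _ _ _ _ hx' hm' r0 r1 r2 r3 =>
      have j0 := i0 _ (by simp) r0
      simp only [Bool.false_eq_true, if_false] at j0
      obtain ⟨rfl, j0⟩ := j0
      have j1 := i1 _ (fun _ => rfl) r1
      have j2 := i2 _ (fun _ => rfl) r2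
      have j3 := i3 _ hk r3
      simp only [if_true] at j1 j2
      have key : Same Q Q' (child m' (ρ 0)) → Same Q Q' x := fun s =>
        same_of Q Q' x hx hx' π (j0 (same_of Q Q' m' hm hm' ρ s j1.2 j2.2)) j1.1 j2.1
      cases k
      · simp only [Bool.false_eq_true, if_false] at j3 ⊢
        exact ⟨j3.1, fun s => key (j3.2 s)⟩
      · simp only [if_true] at j3 ⊢
        exact ⟨key j3.1, j3.2⟩
  | br x m y π ρ t0 t1 t2 t3 hx hm _ _ _ _ i0 i1 i2 i3 =>
    intro y' hk h'
    obtain rfl := hk rfl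
    cases h' with
    | br _ m' _ _ _ _ _ _ _ hx' hm' r0 r1 r2 r3 =>
      have j0 := i0 _ (by simp) r0
      simp only [Bool.false_eq_true, if_false] at j0
      obtain ⟨rfl, j0⟩ := j0
      have j1 := i1 _ (fun _ => rfl) r1
      have j2 := i2 _ (fun _ => rfl) r2
      have j3 := i3 _ (fun _ => rfl) r3
      simp only [if_true] at j1 j2 j3 ⊢
      exact ⟨j3.1,
        same_of Q Q' _ hx hx' π (j0 (same_of Q Q' m' hm hm' ρ j3.2 j1.2 j2.2)) j1.1 j2.1⟩

theorem R_inj (Q Q' : Couple) (t : Tm) (h : R Q true (true, []) (false, []) t)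
    (h' : R Q' true (true, []) (false, []) t) : Q = Q' := by
  have := R_det Q Q' _ _ _ _ h _ (fun _ => rfl) h'
  simp only [if_true] at this
  obtain ⟨⟨s1, a1⟩, s2, a2⟩ := this
  have hp : Q.pos = Q'.pos := by
    simpa [Couple.sub, subtreeAt?_nil, Couple.treeOf] using s1
  have hn : Q.neg = Q'.neg := by
    simpa [Couple.sub, subtreeAt?_nil, Couple.treeOf] using s2
  have hpair : Q.pair = Q'.pair := by
    funext z
    by_cases hz : Q.IsLeaf z
    · obtain ⟨b, p⟩ := z
      cases b
      · exact a2 _ ⟨rfl, List.nil_prefix⟩ hz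
      · exact a1 _ ⟨rfl, List.nil_prefix⟩ hz
    · rw [Q.pair_norm z hz, Q'.pair_norm z]
      rw [← hp, ← hn]
      exact hz
  cases Q
  cases Q'
  simp only at hp hn hpair
  subst hp hn hpair
  rfl

/-! ### Step A -/

theorem normalize_leaf (Q : Couple) (f : NodeId → NodeId) (x : NodeId) (h : Q.IsLeaf x) :
    normalizePair Q.pos Q.neg f x = f x := if_pos h


def LeafF (T : Bool → TTree) (z : NodeId) : Prop := (T z.1).IsLeafPos z.2
def BranchF (T : Bool → TTree) (z : NodeId) : Prop := (T z.1).IsBranchPos z.2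

/-- Replace the subtree at `l` in a pair of trees. -/
def upd (T : Bool → TTree) (l : NodeId) (s : TTree) : Bool → TTree :=
  fun c => if l.1 = c then (T c).replaceAt l.2 s else T c

theorem graft2_eq (T : Bool → TTree) (c : Bool) (l l' : NodeId) (s : TTree) :
    graft2 (T c) c l l' s = upd (upd T l s) l' s c := rfl

theorem upd_leaf (T : Bool → TTree) (l z : NodeId) (s : TTree) (hl : LeafF T l) (hz : LeafF T z)
    (h : z ≠ l) : LeafF (upd T l s) z := by
  obtain ⟨b, p⟩ := l
  obtain ⟨b', p'⟩ := z
  unfold LeafF upd at *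
  simp only at *
  split_ifs with hb
  · subst hb
    refine replaceAt_leaf _ _ _ _ (fun hp => h ?_) hz
    rw [leaf_prefix _ _ _ _ hl hz hp]
  · exact hz

theorem upd_branch (T : Bool → TTree) (l z : NodeId) (s : TTree) (hl : LeafF T l)
    (hz : BranchF T z) : BranchF (upd T l s) z := by
  obtain ⟨b, p⟩ := l
  obtain ⟨b', p'⟩ := z
  unfold LeafF BranchF upd at *
  simp only at *
  split_ifs with hb
  · subst hb
    refine replaceAt_branch _ _ _ _ (fun hp => ?_) hz
    obtain ⟨x, y, w, hz⟩ := hz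
    have := leaf_prefix _ _ _ _ hl hz hp
    subst this
    unfold TTree.IsLeafPos at hl
    rw [hl] at hz
    simp at hz
  · exact hz

theorem upd_new_branch (T : Bool → TTree) (l : NodeId) (hl : LeafF T l) :
    BranchF (upd T l oneTree) l := by
  have := replaceAt_append _ _ oneTree _ [] hl
  simp only [List.append_nil, subtreeAt?_nil] at this
  unfold BranchF upd
  simp only [if_true]
  exact ⟨_, _, _, this⟩

theorem upd_new_leaf (T : Bool → TTree) (l : NodeId) (hl : LeafF T l) (j : Fin 3) :
    LeafF (upd T l oneTree) (child l j) := by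
  have := replaceAt_append _ _ oneTree _ [j] hl
  unfold LeafF upd child TTree.IsLeafPos
  simp only [if_true]
  rw [this]
  fin_cases j <;> simp [oneTree, TTree.subtreeAt?]

theorem child_ne_leaf (T : Bool → TTree) (l z : NodeId) (hl : LeafF T l) (hz : LeafF T z)
    (j : Fin 3) : z ≠ child l j := by
  rintro rfl
  have := leaf_prefix _ _ _ _ hl hz ⟨[j], rfl⟩
  simp [child] at this

theorem stepA_R (Q Q' : Couple) (h : StepA Q Q') (k : Bool) (x y : NodeId) (t : Tm)
    (hR : R Q k x y t) : ∃ t', R Q' k x y t' := by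
  obtain ⟨l, σ, hl, hσ, hp, hn, hpair⟩ := h
  set l' := Q.pair l with hl'def
  have hT : Q'.treeOf = upd (upd Q.treeOf l oneTree) l' oneTree := by
    funext c
    rw [← graft2_eq]
    cases c
    · exact hn
    · exact hp
  have hne : l' ≠ l := Q.pair_ne l hl
  have hl' : Q.IsLeaf l' := Q.pair_leaf l hl
  have hinv : Q.pair l' = l := Q.pair_invol l hl
  have hl1 : LeafF (upd Q.treeOf l oneTree) l' := upd_leaf _ _ _ _ hl hl' hne
  have leafold : ∀ z, Q.IsLeaf z → z ≠ l → z ≠ l' → Q'.IsLeaf z := by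
    intro z hz h1 h2
    change LeafF Q'.treeOf z
    rw [hT]
    exact upd_leaf _ _ _ _ hl1 (upd_leaf _ _ _ _ hl hz h1) h2
  have branchold : ∀ z, Q.IsBranch z → Q'.IsBranch z := by
    intro z hz
    change BranchF Q'.treeOf z
    rw [hT]
    exact upd_branch _ _ _ _ hl1 (upd_branch _ _ _ _ hl hz)
  have bl : Q'.IsBranch l := by
    change BranchF Q'.treeOf l
    rw [hT]
    exact upd_branch _ _ _ _ hl1 (upd_new_branch _ _ hl)
  have bl' : Q'.IsBranch l' := by
    change BranchF Q'.treeOf l'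
    rw [hT]
    exact upd_new_branch _ _ hl1
  have lc : ∀ j, Q'.IsLeaf (child l j) := by
    intro j
    change LeafF Q'.treeOf _
    rw [hT]
    exact upd_leaf _ _ _ _ hl1 (upd_new_leaf _ _ hl j)
      (fun e => child_ne_leaf _ l l' hl hl' j e.symm)
  have lc' : ∀ j, Q'.IsLeaf (child l' j) := by
    intro j
    change LeafF Q'.treeOf _
    rw [hT]
    exact upd_new_leaf _ _ hl1 j
  have pnew : ∀ j, Q'.pair (child l j) = child l' (σ j) := by
    intro j
    have := lc j
    rw [hpair, normalize_leaf Q' _ _ this]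
    fin_cases j <;> simp [stepAPairRaw, child]
  have pnew' : ∀ j, Q'.pair (child l' (σ j)) = child l j := by
    intro j
    rw [← pnew j]
    exact Q'.pair_invol _ (lc j)
  have pold : ∀ z, Q.IsLeaf z → z ≠ l → z ≠ l' → Q'.pair z = Q.pair z := by
    intro z hz h1 h2
    have := leafold z hz h1 h2
    rw [hpair, normalize_leaf Q' _ _ this]
    have e1 := child_ne_leaf _ l z hl hz
    have e2 := child_ne_leaf _ l' z hl' hz
    unfold stepAPairRaw
    unfold child at e1 e2
    simp [e1, e2]
  have hperm : ∃ τ : P3, ∀ j, τ j = σ j ∧ σ (τ j) = j := by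
    rcases hσ with rfl | rfl
    · exact ⟨1, by simp⟩
    · exact ⟨Equiv.swap 0 2, by decide⟩
  obtain ⟨τ, hτ⟩ := hperm
  have pn1 : ∀ j, Q'.pair (child l j) = child l' (τ j) := fun j => by rw [pnew, (hτ j).1]
  have pn2 : ∀ j, Q'.pair (child l' (τ j)) = child l j := fun j => by rw [(hτ j).1, pnew']
  have pn3 : ∀ j, Q'.pair (child l' j) = child l (τ j) := fun j => by
    conv_lhs => rw [← (hτ j).2]
    exact pnew' _
  have pn4 : ∀ j, Q'.pair (child l (τ j)) = child l' j := fun j => by rw [pnew, (hτ j).2]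
  induction hR with
  | cnil x => exact ⟨_, .cnil x⟩
  | pnil x y hx hy e1 e2 =>
    by_cases h1 : x = l
    · subst h1
      subst e1
      exact ⟨_, .a _ _ τ _ _ _ bl bl'
        (.pnil _ _ (lc _) (lc' _) (pn1 _) (pn2 _)) (.pnil _ _ (lc _) (lc' _) (pn1 _) (pn2 _))
        (.pnil _ _ (lc _) (lc' _) (pn1 _) (pn2 _))⟩
    · by_cases h2 : x = l'
      · have h3 : y = l := by rw [← e1, h2, hinv]
        rw [h2, h3]
        exact ⟨_, .a _ _ τ _ _ _ bl' bl
          (.pnil _ _ (lc' _) (lc _) (pn3 _) (pn4 _)) (.pnil _ _ (lc' _) (lc _) (pn3 _) (pn4 _))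
          (.pnil _ _ (lc' _) (lc _) (pn3 _) (pn4 _))⟩
      · have h3 : y ≠ l := by
          rintro rfl
          exact h2 e2.symm
        have h4 : y ≠ l' := by
          intro h4
          rw [h4, hinv] at e2
          exact h1 e2.symm
        exact ⟨_, .pnil x y (leafold x hx h1 h2) (leafold y hy h3 h4)
          ((pold x hx h1 h2).trans e1) ((pold y hy h3 h4).trans e2)⟩
  | a x y σ t0 t1 t2 hx hy _ _ _ i0 i1 i2 =>
    obtain ⟨_, i0⟩ := i0
    obtain ⟨_, i1⟩ := i1
    obtain ⟨_, i2⟩ := i2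
    exact ⟨_, .a x y σ _ _ _ (branchold _ hx) (branchold _ hy) i0 i1 i2⟩
  | bl k x m y π ρ t0 t1 t2 t3 hx hy _ _ _ _ i0 i1 i2 i3 =>
    obtain ⟨_, i0⟩ := i0
    obtain ⟨_, i1⟩ := i1
    obtain ⟨_, i2⟩ := i2
    obtain ⟨_, i3⟩ := i3
    exact ⟨_, .bl k x m y π ρ _ _ _ _ (branchold _ hx) (branchold _ hy) i0 i1 i2 i3⟩
  | br x m y π ρ t0 t1 t2 t3 hx hy _ _ _ _ i0 i1 i2 i3 =>
    obtain ⟨_, i0⟩ := i0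
    obtain ⟨_, i1⟩ := i1
    obtain ⟨_, i2⟩ := i2
    obtain ⟨_, i3⟩ := i3
    exact ⟨_, .br x m y π ρ _ _ _ _ (branchold _ hx) (branchold _ hy) i0 i1 i2 i3⟩

/-! ### Step B -/

theorem mini_perms (i : Fin 3) (v : Bool) : ∃ π ρ : P3, π 0 = i ∧ ρ 0 = loneIdx i v ∧
    bPairs i v = (([π 1], [π 0, ρ 1]), ([π 2], [π 0, ρ 2])) := by
  revert i v
  decide

theorem child_bump (c : Bool) (q : Pos) (i n : Fin 3) (x : NodeId) (j : Fin 3) :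
    child (bump c q i n x) j =
      if child x j = (c, q) then child x j else bump c q i n (child x j) := by
  obtain ⟨b, p⟩ := x
  unfold bump child
  simp only
  by_cases h : b = c ∧ q <+: p
  · obtain ⟨rfl, r, rfl⟩ := h
    simp
  · rw [if_neg h]
    by_cases h2 : b = c
    · subst h2
      simp only [true_and] at h
      by_cases h3 : p ++ [j] = q
      · simp [h3]
      · have : ¬ q <+: p ++ [j] := by
          rw [List.prefix_concat_iff]
          rintro (e | e)
          · exact h3 e.symm
          · exact h e
        simp [h3, this]
    · simp [h2]

/-- The new address of the node `x` seen as a slot. -/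
def slot (c : Bool) (q : Pos) (i n : Fin 3) (x : NodeId) : NodeId :=
  if x = (c, q) then x else bump c q i n x

theorem miniT_sub (i n : Fin 3) (S : TTree) (r : Pos) :
    (miniT i n S).subtreeAt? (i :: n :: r) = S.subtreeAt? r := by
  fin_cases i <;> fin_cases n <;> simp [miniT, gchildT, TTree.subtreeAt?]

theorem miniT_branch0 (i n : Fin 3) (S : TTree) : (miniT i n S).IsBranchPos [] :=
  ⟨_, _, _, rfl⟩

theorem miniT_branch1 (i n : Fin 3) (S : TTree) : (miniT i n S).IsBranchPos [i] := by
  fin_cases i <;> exact ⟨_, _, _, by simp [miniT, TTree.subtreeAt?]; rfl⟩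

theorem miniT_leaf1 (i n : Fin 3) (S : TTree) (j : Fin 3) (h : j ≠ i) :
    (miniT i n S).IsLeafPos [j] := by
  unfold TTree.IsLeafPos
  fin_cases i <;> fin_cases j <;> simp [miniT, TTree.subtreeAt?] at h ⊢

theorem miniT_leaf2 (i n : Fin 3) (S : TTree) (j : Fin 3) (h : j ≠ n) :
    (miniT i n S).IsLeafPos [i, j] := by
  unfold TTree.IsLeafPos
  fin_cases i <;> fin_cases n <;> fin_cases j <;> simp [miniT, gchildT, TTree.subtreeAt?] at h ⊢

theorem stepB_R (Q Q' : Couple) (c : Bool) (q : Pos) (i : Fin 3) (v : Bool)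
    (h : StepBAt Q Q' c q i v) (k : Bool) (x y : NodeId) (t : Tm)
    (hR : R Q k x y t) : ∃ t', R Q' k (slot c q i (loneIdx i v) x)
      (cond k (slot c q i (loneIdx i v) y) (bump c q i (loneIdx i v) y)) t' := by
  obtain ⟨S, hS, hc, hnc, hpair⟩ := h
  obtain ⟨π, ρ, hπ, hρ, hb⟩ := mini_perms i v
  set n := loneIdx i v with hn
  -- the mini tree
  have hin : ∀ r s, (miniT i n S).subtreeAt? r = s → (Q'.treeOf c).subtreeAt? (q ++ r) = s := by
    intro r s h
    rw [hc, replaceAt_append _ _ _ _ _ hS, h]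
  have b0 : Q'.IsBranch (c, q) := by
    obtain ⟨x, y, z, h⟩ := miniT_branch0 i n S
    have := hin _ _ h
    exact ⟨x, y, z, by simpa using this⟩
  have b1 : Q'.IsBranch (child (c, q) (π 0)) := by
    obtain ⟨x, y, z, h⟩ := miniT_branch1 i n S
    have := hin _ _ h
    exact ⟨x, y, z, by simpa [child, hπ] using this⟩
  have l1 : ∀ j, j ≠ 0 → Q'.IsLeaf (child (c, q) (π j)) := by
    intro j hj
    have := hin _ _ (miniT_leaf1 i n S (π j) (by rw [← hπ]; simpa using hj))
    exact this
  have l2 : ∀ j, j ≠ 0 → Q'.IsLeaf (child (child (c, q) (π 0)) (ρ j)) := by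
    intro j hj
    have := hin _ _ (miniT_leaf2 i n S (ρ j) (by rw [← hρ]; simpa using hj))
    simpa [Couple.IsLeaf, child, hπ, TTree.IsLeafPos] using this
  have p1 : ∀ j, j ≠ 0 →
      Q'.pair (child (c, q) (π j)) = child (child (c, q) (π 0)) (ρ j) := by
    intro j hj
    have hl := l1 j hj
    rw [hpair, normalize_leaf Q' _ _ hl]
    unfold stepBPairRaw
    rw [hb]
    fin_cases j
    · exact absurd rfl hj
    · simp [child]
    · simp [child]
  have p2 : ∀ j, j ≠ 0 →
      Q'.pair (child (child (c, q) (π 0)) (ρ j)) = child (c, q) (π j) := by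
    intro j hj
    rw [← p1 j hj]
    exact Q'.pair_invol _ (l1 j hj)
  have pn : ∀ j, j ≠ 0 → R Q' true (child (c, q) (π j)) (child (child (c, q) (π 0)) (ρ j)) .nil :=
    fun j hj => .pnil _ _ (l1 j hj) (l2 j hj) (p1 j hj) (p2 j hj)
  have hbq : bump c q i n (c, q) = child (child (c, q) (π 0)) (ρ 0) := by
    simp [bump, child, hπ, hρ]
  have wrapL : ∀ k x y t, R Q' k (bump c q i n x) y t → ∃ t', R Q' k (slot c q i n x) y t' := by
    intro k x y t h
    unfold slot
    split_ifs with hx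
    · subst hx
      rw [hbq] at h
      exact ⟨_, .bl k _ _ _ π ρ _ _ _ _ b0 b1 (.cnil _) (pn 1 (by decide)) (pn 2 (by decide)) h⟩
    · exact ⟨t, h⟩
  have wrapR : ∀ x y t, R Q' true x (bump c q i n y) t → ∃ t', R Q' true x (slot c q i n y) t' := by
    intro x y t h
    unfold slot
    split_ifs with hx
    · subst hx
      rw [hbq] at h
      exact ⟨_, .br _ _ _ π ρ _ _ _ _ b0 b1 (.cnil _) (pn 1 (by decide)) (pn 2 (by decide)) h⟩
    · exact ⟨t, h⟩
  have wrap2 : ∀ x y, (∃ t, R Q' true (bump c q i n x) (bump c q i n y) t) →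
      ∃ t', R Q' true (slot c q i n x) (slot c q i n y) t' := by
    rintro x y ⟨t, h⟩
    obtain ⟨t', h'⟩ := wrapL _ _ _ _ h
    exact wrapR _ _ _ h'
  have hsl : ∀ x j, slot c q i n (child x j) = child (bump c q i n x) j :=
    fun x j => (child_bump c q i n x j).symm
  -- old nodes
  have subin : ∀ p, (Q'.treeOf c).subtreeAt? (q ++ i :: n :: p) =
      (Q.treeOf c).subtreeAt? (q ++ p) := by
    intro p
    rw [hin _ _ (miniT_sub i n S p), subtreeAt?_append, hS]
    rfl
  have leafold : ∀ z, Q.IsLeaf z → Q'.IsLeaf (bump c q i n z) := by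
    rintro ⟨b, p⟩ hz
    unfold bump
    simp only
    split_ifs with hp
    · obtain ⟨rfl, r, rfl⟩ := hp
      have := subin r
      unfold Couple.IsLeaf TTree.IsLeafPos at *
      simpa [this] using hz
    · unfold Couple.IsLeaf at *
      simp only at *
      by_cases hbc : b = c
      · subst hbc
        rw [hc]
        exact replaceAt_leaf _ _ _ _ (fun h => hp ⟨rfl, h⟩) hz
      · have : b = !c := Bool.eq_not_of_ne hbc
        subst this
        rw [hnc]
        exact hz
  have branchold : ∀ z, Q.IsBranch z → Q'.IsBranch (bump c q i n z) := by
    rintro ⟨b, p⟩ hz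
    unfold bump
    simp only
    split_ifs with hp
    · obtain ⟨rfl, r, rfl⟩ := hp
      have := subin r
      unfold Couple.IsBranch TTree.IsBranchPos at *
      simpa [this] using hz
    · unfold Couple.IsBranch at *
      simp only at *
      by_cases hbc : b = c
      · subst hbc
        rw [hc]
        exact replaceAt_branch _ _ _ _ (fun h => hp ⟨rfl, h⟩) hz
      · have : b = !c := Bool.eq_not_of_ne hbc
        subst this
        rw [hnc]
        exact hz
  have pold : ∀ z, Q.IsLeaf z → Q'.pair (bump c q i n z) = bump c q i n (Q.pair z) := by
    rintro z hz
    have hl := leafold z hz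
    rw [hpair, normalize_leaf Q' _ _ hl]
    obtain ⟨b, p⟩ := z
    unfold stepBPairRaw
    rw [hb, ← hn]
    by_cases hp : b = c ∧ q <+: p
    · obtain ⟨rfl, r, rfl⟩ := hp
      have e : bump b q i n (b, q ++ r) = (b, q ++ i :: n :: r) := by simp [bump]
      have ei : ∀ j, j ≠ 0 → i ≠ π j := fun j hj => by
        rw [← hπ]; intro h; exact hj (π.injective h).symm
      have en : ∀ j, j ≠ 0 → n ≠ ρ j := fun j hj => by
        rw [← hρ]; intro h; exact hj (ρ.injective h).symm
      have ei1 := ei 1 (by decide)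
      have ei2 := ei 2 (by decide)
      have en1 := en 1 (by decide)
      have en2 := en 2 (by decide)
      rw [e]
      have ed : List.drop (q.length + 2) q = [] := List.drop_eq_nil_of_le (by omega)
      simp [ei1, ei2, en1, en2, List.drop_append, ed]
    · have e : bump c q i n (b, p) = (b, p) := by
        unfold bump
        rw [if_neg hp]
      have hne : ∀ r, ((b, p) : NodeId) ≠ (c, q ++ r) := by
        intro r h
        simp only [Prod.mk.injEq] at h
        exact hp ⟨h.1, r, h.2.symm⟩
      have hp2 : ¬ (b = c ∧ q ++ [i, n] <+: p) := by
        rintro ⟨h1, h2⟩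
        exact hp ⟨h1, (List.prefix_append q [i, n]).trans h2⟩
      rw [e]
      simp only [hne, if_false]
      rw [if_neg hp2]
  have main : ∃ t', R Q' k (bump c q i n x) (bump c q i n y) t' := by
    induction hR with
    | cnil x => exact ⟨_, .cnil _⟩
    | pnil x y hx hy e1 e2 =>
      exact ⟨_, .pnil _ _ (leafold _ hx) (leafold _ hy) (by rw [pold _ hx, e1])
        (by rw [pold _ hy, e2])⟩
    | a x y σ t0 t1 t2 hx hy _ _ _ i0 i1 i2 =>
      obtain ⟨_, i0⟩ := wrap2 _ _ i0
      obtain ⟨_, i1⟩ := wrap2 _ _ i1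
      obtain ⟨_, i2⟩ := wrap2 _ _ i2
      rw [hsl, hsl] at i0 i1 i2
      exact ⟨_, .a _ _ σ _ _ _ (branchold _ hx) (branchold _ hy) i0 i1 i2⟩
    | bl k x m y π ρ t0 t1 t2 t3 hx hy _ _ _ _ i0 i1 i2 i3 =>
      obtain ⟨_, i0⟩ := i0
      obtain ⟨_, i3⟩ := i3
      obtain ⟨_, i0⟩ := wrapL _ _ _ _ i0
      obtain ⟨_, i1⟩ := wrap2 _ _ i1
      obtain ⟨_, i2⟩ := wrap2 _ _ i2
      obtain ⟨_, i3⟩ := wrapL _ _ _ _ i3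
      rw [hsl] at i0 i3
      rw [hsl, hsl] at i1 i2
      exact ⟨_, .bl k _ _ _ π ρ _ _ _ _ (branchold _ hx) (branchold _ hy) i0 i1 i2 i3⟩
    | br x m y π ρ t0 t1 t2 t3 hx hy _ _ _ _ i0 i1 i2 i3 =>
      obtain ⟨_, i0⟩ := i0
      obtain ⟨_, i3⟩ := i3
      obtain ⟨_, i0⟩ := wrapL _ _ _ _ i0
      obtain ⟨_, i1⟩ := wrap2 _ _ i1
      obtain ⟨_, i2⟩ := wrap2 _ _ i2
      obtain ⟨_, i3⟩ := wrapR _ _ _ i3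
      rw [hsl] at i0 i3
      rw [hsl, hsl] at i1 i2
      exact ⟨_, .br _ _ _ π ρ _ _ _ _ (branchold _ hx) (branchold _ hy) i0 i1 i2 i3⟩
  obtain ⟨t', h⟩ := main
  cases k
  · exact wrapL _ _ _ _ h
  · exact wrap2 _ _ ⟨t', h⟩

theorem slot_root (c : Bool) (q : Pos) (i n : Fin 3) (b : Bool) :
    slot c q i n (b, []) = (b, []) := by
  unfold slot bump
  split_ifs with h1 h2
  · rfl
  · exfalso
    obtain ⟨rfl, h2⟩ := h2
    simp only [List.prefix_nil] at h2
    subst h2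
    exact h1 rfl
  · rfl

theorem regular_R (Q : Couple) (h : Regular Q) : ∃ t, R Q true (true, []) (false, []) t := by
  unfold Regular at h
  induction h with
  | refl =>
    refine ⟨.nil, .pnil _ _ ?_ ?_ ?_ ?_⟩
    · exact (isLeafPos_leaf_iff []).mpr rfl
    · exact (isLeafPos_leaf_iff []).mpr rfl
    · decide
    · decide
  | tail _ hs ih =>
    obtain ⟨t, ht⟩ := ih
    rcases hs with hs | ⟨c, q, i, v, hs⟩
    · exact stepA_R _ _ hs _ _ _ _ ht
    · have := stepB_R _ _ c q i v hs _ _ _ _ ht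
      simpa only [cond_true, slot_root] using this

/-! ### Counting terms -/

/-- Terms of bounded height. -/
noncomputable def bt : ℕ → Finset Tm
  | 0 => ∅
  | h + 1 => by
    classical
    exact insert Tm.nil
      (((Finset.univ : Finset P3) ×ˢ (bt h ×ˢ bt h ×ˢ bt h)).image
          (fun u => Tm.A u.1 u.2.1 u.2.2.1 u.2.2.2) ∪
        ((Finset.univ : Finset (Bool × P3 × P3)) ×ˢ (bt h ×ˢ bt h ×ˢ bt h ×ˢ bt h)).image
          (fun u => Tm.B u.1.1 u.1.2.1 u.1.2.2 u.2.1 u.2.2.1 u.2.2.2.1 u.2.2.2.2))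

theorem mem_bt (t : Tm) : ∀ h, t.size < h → t ∈ bt h := by
  induction t with
  | nil =>
    intro h hh
    cases h with
    | zero => omega
    | succ h => simp [bt]
  | A σ a b c ia ib ic =>
    intro h hh
    cases h with
    | zero => omega
    | succ h =>
      simp only [Tm.size] at hh
      have := ia h (by omega)
      have := ib h (by omega)
      have := ic h (by omega)
      simp [bt, *]
  | B s π ρ a b c d ia ib ic id =>
    intro h hh
    cases h with
    | zero => omega
    | succ h =>
      simp only [Tm.size] at hh
      have := ia h (by omega)
      have := ib h (by omega)
      have := ic h (by omega)
      have := id h (by omega)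
      simp [bt, *]

/-- The weight of a term. -/
noncomputable def wt (t : Tm) : ℝ := (1 / 10000 : ℝ) ^ t.size

theorem wt_nonneg (t : Tm) : 0 ≤ wt t := by unfold wt; positivity

theorem card_P3 : Fintype.card P3 = 6 := by decide

theorem sum_A (s : Finset Tm) :
    ∑ u ∈ (Finset.univ : Finset P3) ×ˢ (s ×ˢ s ×ˢ s), wt (Tm.A u.1 u.2.1 u.2.2.1 u.2.2.2) =
      6 * (1 / 10000) * (∑ t ∈ s, wt t) ^ 3 := by
  have : ∀ u : P3 × Tm × Tm × Tm, wt (Tm.A u.1 u.2.1 u.2.2.1 u.2.2.2) =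
      (1 / 10000) * (wt u.2.1 * (wt u.2.2.1 * wt u.2.2.2)) := by
    intro u
    simp only [wt, Tm.size, pow_add, pow_one]
    ring
  simp only [this, ← Finset.mul_sum, Finset.sum_product, ← Finset.sum_mul]
  simp [card_P3]
  ring

theorem sum_B (s : Finset Tm) :
    ∑ u ∈ (Finset.univ : Finset (Bool × P3 × P3)) ×ˢ (s ×ˢ s ×ˢ s ×ˢ s),
      wt (Tm.B u.1.1 u.1.2.1 u.1.2.2 u.2.1 u.2.2.1 u.2.2.2.1 u.2.2.2.2) =
      72 * (1 / 10000) * (∑ t ∈ s, wt t) ^ 4 := by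
  have : ∀ u : (Bool × P3 × P3) × Tm × Tm × Tm × Tm,
      wt (Tm.B u.1.1 u.1.2.1 u.1.2.2 u.2.1 u.2.2.1 u.2.2.2.1 u.2.2.2.2) =
      (1 / 10000) * (wt u.2.1 * (wt u.2.2.1 * (wt u.2.2.2.1 * wt u.2.2.2.2))) := by
    intro u
    simp only [wt, Tm.size, pow_add, pow_one]
    ring
  simp only [this, ← Finset.mul_sum, Finset.sum_product, ← Finset.sum_mul]
  simp [card_P3]
  ring

theorem sum_bt (h : ℕ) : ∑ t ∈ bt h, wt t ≤ 2 := by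
  induction h with
  | zero => simp [bt]
  | succ h ih =>
    classical
    have h0 : 0 ≤ ∑ t ∈ bt h, wt t := Finset.sum_nonneg fun t _ => wt_nonneg t
    have h3 : (∑ t ∈ bt h, wt t) ^ 3 ≤ 2 ^ 3 := pow_le_pow_left₀ h0 ih 3
    have h4 : (∑ t ∈ bt h, wt t) ^ 4 ≤ 2 ^ 4 := pow_le_pow_left₀ h0 ih 4
    have hA := sum_A (bt h)
    have hB := sum_B (bt h)
    rw [← Finset.sum_image (s := _) (f := wt) (g := fun u : P3 × Tm × Tm × Tm =>
      Tm.A u.1 u.2.1 u.2.2.1 u.2.2.2) (by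
        rintro ⟨_, _, _, _⟩ _ ⟨_, _, _, _⟩ _ e
        simpa using e)] at hA
    rw [← Finset.sum_image (s := _) (f := wt) (g := fun u : (Bool × P3 × P3) × Tm × Tm × Tm × Tm =>
      Tm.B u.1.1 u.1.2.1 u.1.2.2 u.2.1 u.2.2.1 u.2.2.2.1 u.2.2.2.2) (by
        rintro ⟨⟨_, _, _⟩, _, _, _, _⟩ _ ⟨⟨_, _, _⟩, _, _, _, _⟩ _ e
        simp only [Tm.B.injEq] at e
        simp [e])] at hB
    have hnil : wt .nil = 1 := by simp [wt, Tm.size]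
    simp only [bt]
    rw [Finset.sum_insert (by simp), hnil]
    have hU := Finset.sum_union_inter (f := wt)
      (s₁ := ((Finset.univ : Finset P3) ×ˢ (bt h ×ˢ bt h ×ˢ bt h)).image
          (fun u => Tm.A u.1 u.2.1 u.2.2.1 u.2.2.2))
      (s₂ := ((Finset.univ : Finset (Bool × P3 × P3)) ×ˢ (bt h ×ˢ bt h ×ˢ bt h ×ˢ bt h)).image
          (fun u => Tm.B u.1.1 u.1.2.1 u.1.2.2 u.2.1 u.2.2.1 u.2.2.2.1 u.2.2.2.2))
    have hI := Finset.sum_nonneg (s := ((Finset.univ : Finset P3) ×ˢ (bt h ×ˢ bt h ×ˢ bt h)).image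
          (fun u => Tm.A u.1 u.2.1 u.2.2.1 u.2.2.2) ∩
        ((Finset.univ : Finset (Bool × P3 × P3)) ×ˢ (bt h ×ˢ bt h ×ˢ bt h ×ˢ bt h)).image
          (fun u => Tm.B u.1.1 u.1.2.1 u.1.2.2 u.2.1 u.2.2.1 u.2.2.2.1 u.2.2.2.2))
          (fun t _ => wt_nonneg t)
    linarith

theorem size_zero (t : Tm) (h : t.size = 0) : t = .nil := by
  cases t <;> simp [Tm.size] at h ⊢

set_option linter.constructorNameAsVariable false in
/-- Terms of size `m`. -/
theorem count_tm (m : ℕ) : {t : Tm | t.size = m}.Finite ∧ {t : Tm | t.size = m}.ncard ≤ 10000 ^ m := by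
  classical
  have hsub : {t : Tm | t.size = m} = ((bt (m + 1)).filter (fun t => t.size = m) : Finset Tm) := by
    ext t
    simp only [Set.mem_ofPred_eq, Finset.coe_filter]
    exact ⟨fun h => ⟨mem_bt t _ (by omega), h⟩, fun h => h.2⟩
  rw [hsub]
  refine ⟨Finset.finite_toSet _, ?_⟩
  rw [Set.ncard_coe_finset]
  set F := (bt (m + 1)).filter (fun t => t.size = m) with hF
  rcases Nat.eq_zero_or_pos m with rfl | hm
  · have : F ⊆ {Tm.nil} := by
      intro t ht
      simp only [hF, Finset.mem_filter] at ht
      simp [size_zero t ht.2]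
    simpa using Finset.card_le_card this
  · have hn : Tm.nil ∉ F := by
      simp only [hF, Finset.mem_filter, Tm.size]
      omega
    have h1 : insert Tm.nil F ⊆ bt (m + 1) := by
      intro t ht
      rcases Finset.mem_insert.mp ht with rfl | ht
      · exact mem_bt _ _ (by simp [Tm.size])
      · exact (Finset.mem_filter.mp ht).1
    have h2 := Finset.sum_le_sum_of_subset_of_nonneg (f := wt) h1 (fun t _ _ => wt_nonneg t)
    have hnil : wt .nil = 1 := by simp [wt, Tm.size]
    rw [Finset.sum_insert hn, hnil] at h2
    have h3 : ∑ t ∈ F, wt t = F.card * (1 / 10000 : ℝ) ^ m := by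
      rw [Finset.sum_congr rfl (g := fun _ => (1 / 10000 : ℝ) ^ m)]
      · simp
      · intro t ht
        simp only [hF, Finset.mem_filter] at ht
        rw [wt, ht.2]
    have h4 := sum_bt (m + 1)
    have h5 : (F.card : ℝ) * (1 / 10000 : ℝ) ^ m ≤ 1 := by linarith
    rw [one_div, inv_pow, ← div_eq_mul_inv, div_le_one (by positivity)] at h5
    exact_mod_cast h5

/-- Corollary 3.6 of Deng–Hani: the number of regular couples of scale `n` is at most
`100 ^ n`. -/
theorem count_regular_couples (n : ℕ) :
    {Q : Couple | Regular Q ∧ Q.scale = n}.Finite ∧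
      {Q : Couple | Regular Q ∧ Q.scale = n}.ncard ≤ 100 ^ n := by
  classical
  let f : Couple → Tm := fun Q =>
    if h : ∃ t, R Q true (true, []) (false, []) t then h.choose else .nil
  have hf : ∀ Q, Regular Q → R Q true (true, []) (false, []) (f Q) := by
    intro Q hQ
    have h := regular_R Q hQ
    simp only [f, dif_pos h]
    exact h.choose_spec
  have hsz : ∀ Q, Regular Q → Q.scale = 2 * (f Q).size := by
    intro Q hQ
    have := R_size Q _ _ _ _ (hf Q hQ)
    simpa [Couple.sc, Couple.sub, subtreeAt?_nil, Couple.treeOf, Couple.scale] using this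
  obtain ⟨fin, cnt⟩ := count_tm (n / 2)
  have maps : ∀ Q ∈ {Q : Couple | Regular Q ∧ Q.scale = n}, f Q ∈ {t : Tm | t.size = n / 2} := by
    rintro Q ⟨hQ, hn⟩
    have := hsz Q hQ
    simp only [Set.mem_ofPred_eq]
    omega
  have inj : Set.InjOn f {Q : Couple | Regular Q ∧ Q.scale = n} := by
    rintro Q ⟨hQ, -⟩ Q' ⟨hQ', -⟩ e
    have h' := hf Q' hQ'
    rw [← e] at h'
    exact R_inj Q Q' _ (hf Q hQ) h'
  refine ⟨Set.Finite.of_injOn maps inj fin, (Set.ncard_le_ncard_of_injOn f maps inj fin).trans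
    (cnt.trans ?_)⟩
  calc (10000 : ℕ) ^ (n / 2) = 100 ^ (2 * (n / 2)) := by rw [pow_mul]; norm_num
    _ ≤ 100 ^ n := Nat.pow_le_pow_right (by norm_num) (by omega)


end WKE
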